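/- arXiv:math/0208165 — 4 statements merged into one kernel-verified Lean document; each statement's English description precedes it below -/
import Mathlib

section
/- Let 𝓤 be an ultrafilter on ℕ and for each n let G n be a simple graph on a nonempty vertex type X n. Then {n | (G n).Connected} ∈ 𝓤 if and only if for every pair of sequences x, y ∈ Π n, X n one has {n | (G n).Reachable (x n) (y n)} ∈ 𝓤. (The nonstandard graph is connected precisely when any two nonstandard vertices are joined by a hyperfinite path.) -/
open Filter

/-- The nonstandard graph is connected precisely when any two nonstandard vertices are joined
by a hyperfinite path: `{n | G n is connected} ∈ 𝓤` iff for all sequences of vertices `x, y`,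
`x n` and `y n` are reachable from one another in `G n` for almost all `n`. -/
theorem connected_ae_iff_reachable_ae (𝓤 : Ultrafilter ℕ) {X : ℕ → Type*}
    [∀ n, Nonempty (X n)] (G : ∀ n, SimpleGraph (X n)) :
    {n | (G n).Connected} ∈ 𝓤 ↔
      ∀ x y : ∀ n, X n, {n | (G n).Reachable (x n) (y n)} ∈ 𝓤 := by
  refine ⟨fun h x y => mem_of_superset h fun n hn => hn.preconnected (x n) (y n), fun h => ?_⟩
  have separating_pair : ∀ n, ∃ p : X n × X n,
      (G n).Reachable p.1 p.2 → (G n).Connected := by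
    intro n
    by_contra! hn
    obtain ⟨v⟩ := ‹∀ n, Nonempty (X n)› n
    exact (hn (v, v)).2 ⟨fun a b => (hn (a, b)).1⟩
  choose p hp using separating_pair
  exact mem_of_superset (h (fun n => (p n).1) fun n => (p n).2) hp
end

section
/- Let 𝓤 be an ultrafilter on ℕ. For each n let G n be a simple graph on a finite vertex type X n with |X n| ≥ 3. If {n | every vertex x of G n satisfies 2·deg(x) ≥ |X n|} ∈ 𝓤, then {n | G n is Hamiltonian} ∈ 𝓤. (The nonstandard version of Dirac's criterion: if every nonstandard vertex has degree at least half the hypernatural number of vertices, the nonstandard graph is Hamiltonian.) -/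
open Filter

namespace SimpleGraph

variable {V : Type*} {G : SimpleGraph V} {u v : V}

namespace Walk

/-- A path whose ends have consecutive crossing neighbours on it closes up to a cycle. -/
theorem IsPath.exists_isCycle_of_adj_getVert {p : G.Walk u v} (hp : p.IsPath) {i : ℕ}
    (hi : i < p.length) (hlen : 2 ≤ p.length) (hu : G.Adj u (p.getVert (i + 1)))
    (hv : G.Adj v (p.getVert i)) :
    ∃ c : G.Walk u u, c.IsCycle ∧ c.length = p.length + 1 := by
  let q := (p.drop (i + 1)).append (.cons hv (p.take i).reverse)
  have hqlen : q.length = p.length := by simp [q]; lia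
  have hq : q.IsPath := by
    refine IsPath.mk' ?_
    have hsupp : q.support = p.support.drop (i + 1) ++ (p.support.take (i + 1)).reverse := by
      simp [q, support_append, support_take, Nat.min_eq_left hi]
    have hperm : q.support.Perm p.support := by
      rw [hsupp]
      refine ((List.reverse_perm _).append_left _).trans (List.perm_append_comm.trans ?_)
      rw [List.take_append_drop]
    exact hperm.nodup_iff.2 hp.support_nodup
  refine ⟨.cons hu q, ?_, by simp [hqlen]⟩
  rw [isCycle_iff_isPath_tail_and_le_length]
  refine ⟨by simpa using hq, ?_⟩
  rw [length_cons]
  lia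

/-- A vertex off a cycle but adjacent to it starts a path as long as the cycle. -/
theorem IsCycle.exists_isPath_of_adj {c : G.Walk u u} (hc : c.IsCycle) {x w : V}
    (hx : x ∈ c.support) (hw : w ∉ c.support) (h : G.Adj x w) :
    ∃ (y : V) (p : G.Walk y w), p.IsPath ∧ p.length = c.length := by
  classical
  have hr := hc.rotate hx
  refine ⟨_, (c.rotate x hx).tail.concat h, hr.isPath_tail.concat (fun hmem => hw ?_) h, ?_⟩
  · rw [support_tail_of_not_nil _ hr.not_nil] at hmem
    exact (mem_support_rotate_iff c x hx).1 (List.mem_of_mem_tail hmem)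
  · rw [length_concat, length_tail_add_one hr.not_nil, length_rotate]

end Walk

section Finite

variable [Fintype V] [DecidableRel G.Adj]

/-- If no path is longer than `p`, then all neighbours of the end of `p` lie on `p`. -/
theorem Walk.IsPath.degree_le_card_filter {p : G.Walk u v} (hp : p.IsPath)
    (hmax : ∀ (x y : V) (q : G.Walk x y), q.IsPath → q.length ≤ p.length) :
    G.degree v ≤ Finset.card {i ∈ Finset.range p.length | G.Adj v (p.getVert i)} := by
  classical
  rw [← card_neighborFinset_eq_degree]
  refine (Finset.card_le_card fun w hw => ?_).trans (Finset.card_image_le (f := p.getVert))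
  rw [mem_neighborFinset] at hw
  have hmem : w ∈ p.support := by
    by_contra hmem
    have := hmax _ _ _ (hp.concat hmem hw)
    rw [length_concat] at this
    lia
  obtain ⟨i, rfl, hi⟩ := Walk.mem_support_iff_exists_getVert.1 hmem
  have hne : i ≠ p.length := by
    rintro rfl
    simp at hw
  exact Finset.mem_image_of_mem _ (by simp [hw]; lia)

/-- If no path is longer than `p`, and the degrees of its ends sum to at least the number of
vertices, then `p` closes up to a cycle. -/
theorem Walk.IsPath.exists_isCycle_of_card_le_degree_add_degree {p : G.Walk u v} (hp : p.IsPath)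
    (hmax : ∀ (x y : V) (q : G.Walk x y), q.IsPath → q.length ≤ p.length)
    (hlen : 2 ≤ p.length) (hdeg : Fintype.card V ≤ G.degree u + G.degree v) :
    ∃ c : G.Walk u u, c.IsCycle ∧ c.length = p.length + 1 := by
  have hv := hp.degree_le_card_filter hmax
  have hu : G.degree u ≤ Finset.card {i ∈ Finset.range p.length | G.Adj u (p.getVert (i + 1))} := by
    refine (hp.reverse.degree_le_card_filter (by simpa using hmax)).trans ?_
    refine Finset.card_le_card_of_injOn (fun i => p.length - 1 - i) (fun i hi => ?_)
      fun i hi j hj hij => ?_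
    · simp only [Finset.coe_filter, Finset.mem_range, Set.mem_ofPred_eq, length_reverse,
        getVert_reverse] at hi ⊢
      refine ⟨by lia, ?_⟩
      rw [show p.length - 1 - i + 1 = p.length - i by lia]
      exact hi.2
    · simp at hi hj hij
      lia
  obtain ⟨i, hi⟩ := Finset.inter_nonempty_of_card_lt_card_add_card
    (Finset.filter_subset (fun i => G.Adj u (p.getVert (i + 1))) (Finset.range p.length))
    (Finset.filter_subset (fun i => G.Adj v (p.getVert i)) (Finset.range p.length))
    (by rw [Finset.card_range]; have := hp.length_lt; lia)
  simp only [Finset.mem_inter, Finset.mem_filter, Finset.mem_range] at hi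
  exact hp.exists_isCycle_of_adj_getVert hi.1.1 hlen hi.1.2 hi.2.2

/-- Under Dirac's condition, a vertex is adjacent to every set of at least half the vertices
that does not contain it. -/
theorem exists_adj_of_card_le_two_mul_degree {w : V} (h : Fintype.card V ≤ 2 * G.degree w)
    {s : Finset V} (hw : w ∉ s) (hs : Fintype.card V ≤ 2 * s.card) : ∃ x ∈ s, G.Adj x w := by
  classical
  by_contra! hcon
  have hdisj : Disjoint (G.neighborFinset w) (insert w s) := by
    rw [Finset.disjoint_left]
    intro x hx hxs
    rw [mem_neighborFinset] at hx
    obtain rfl | hxs := Finset.mem_insert.1 hxs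
    · exact G.irrefl hx
    · exact hcon x hxs hx.symm
  have := Finset.card_le_univ (G.neighborFinset w ∪ insert w s)
  rw [Finset.card_union_of_disjoint hdisj, card_neighborFinset_eq_degree,
    Finset.card_insert_of_notMem hw] at this
  lia

/-- **Dirac's theorem**. -/
theorem isHamiltonian_of_card_le_two_mul_degree [DecidableEq V] (hcard : 3 ≤ Fintype.card V)
    (h : ∀ x, Fintype.card V ≤ 2 * G.degree x) : G.IsHamiltonian := by
  have : Nonempty V := Fintype.card_pos_iff.1 (by lia)
  obtain ⟨u, v, p, hp, hmax⟩ := Walk.exists_isPath_forall_isPath_length_le_length G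
  have hdeg : G.degree v ≤ p.length :=
    (hp.degree_le_card_filter hmax).trans
      ((Finset.card_filter_le _ _).trans (Finset.card_range _).le)
  have hu := h u
  have hv := h v
  obtain ⟨c, hc, hclen⟩ :=
    hp.exists_isCycle_of_card_le_degree_add_degree hmax (by lia) (by lia)
  refine fun _ => ⟨u, c, hc, (hc.isPath_tail.isHamiltonian_iff).2 ?_⟩
  rw [Walk.support_tail_of_not_nil _ hc.not_nil]
  by_contra! hcon
  obtain ⟨w, hw⟩ := hcon
  have hsupp : c.support.tail.toFinset.card = p.length + 1 := by
    rw [List.toFinset_card_of_nodup hc.support_nodup, List.length_tail, Walk.length_support, hclen]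
    rfl
  obtain ⟨x, hx, hxw⟩ := exists_adj_of_card_le_two_mul_degree (h w)
    (mt List.mem_toFinset.1 hw) (by lia)
  have hwc : w ∉ c.support := by
    rw [← Walk.cons_tail_support, List.mem_cons]
    rintro (rfl | hw')
    · exact hw (Walk.end_mem_tail_support hc.not_nil)
    · exact hw hw'
  obtain ⟨y, q, hq, hqlen⟩ :=
    hc.exists_isPath_of_adj (List.mem_of_mem_tail (List.mem_toFinset.1 hx)) hwc hxw
  have := hmax _ _ q hq
  lia

end Finite

end SimpleGraph

/-- Nonstandard version of Dirac's criterion: if, for almost all `n`, every vertex of the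
finite graph `G n` (with at least 3 vertices) has degree at least half the number of
vertices, then the nonstandard graph is Hamiltonian (almost all `G n` are Hamiltonian). -/
theorem hamiltonian_ae_of_dirac_ae (𝓤 : Ultrafilter ℕ) {X : ℕ → Type*}
    [∀ n, Fintype (X n)] [∀ n, DecidableEq (X n)]
    (G : ∀ n, SimpleGraph (X n)) [∀ n, DecidableRel (G n).Adj]
    (hcard : ∀ n, 3 ≤ Fintype.card (X n))
    (h : {n | ∀ x : X n, Fintype.card (X n) ≤ 2 * (G n).degree x} ∈ 𝓤) :
    {n | (G n).IsHamiltonian} ∈ 𝓤 :=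
  mem_of_superset h fun n hn => SimpleGraph.isHamiltonian_of_card_le_two_mul_degree (hcard n) hn
end

section
/- Let 𝓤 be an ultrafilter on ℕ. For each n let G n be a simple graph on a finite vertex type X n with |X n| ≥ 3. If {n | for every natural number j with 1 ≤ j and 2·j < |X n|, the number of vertices x of G n with deg(x) ≤ j is less than j} ∈ 𝓤, then {n | G n is Hamiltonian} ∈ 𝓤. (The nonstandard version of Pósa's theorem.) -/
open Filter

namespace SimpleGraph

variable {α : Type*} [Fintype α] [DecidableEq α] {G : SimpleGraph α} {u v : α}

/-- A Hamiltonian path with adjacent endpoints closes up to a Hamiltonian cycle. -/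
lemma Walk.IsHamiltonian.isHamiltonian_of_adj {p : G.Walk u v} (hp : p.IsHamiltonian)
    (hcard : 3 ≤ Fintype.card α) (hadj : G.Adj v u) : G.IsHamiltonian := by
  refine fun _ ↦ ⟨v, .cons hadj p, Walk.isHamiltonianCycle_iff_isCycle_and_length_eq.2
    ⟨(Walk.cons_isCycle_iff _ _).2 ⟨hp.isPath, fun he ↦ ?_⟩, ?_⟩⟩
  · have := hp.isPath.length_eq_one_of_mem_edges (Sym2.eq_swap ▸ he)
    have := hp.length_eq
    lia
  · rw [Walk.length_cons, hp.length_eq]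
    lia

/-- If the start of a Hamiltonian path is adjacent to the vertex at position `i + 1` and the end
is adjacent to the vertex at position `i`, then the graph is Hamiltonian. -/
lemma Walk.IsHamiltonian.isHamiltonian_of_crossing {p : G.Walk u v} (hp : p.IsHamiltonian)
    (hcard : 3 ≤ Fintype.card α) {i : ℕ} (hi : i < p.length) (hu : G.Adj u (p.getVert (i + 1)))
    (hv : G.Adj v (p.getVert i)) : G.IsHamiltonian := by
  let q := (p.take i).append (.cons hv.symm (p.drop (i + 1)).reverse)
  have hq : q.support.Perm p.support := by
    have hmin : min (i + 1) p.length = i + 1 := by lia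
    simp only [q, Walk.support_append, Walk.support_cons, List.tail_cons, Walk.support_reverse,
      Walk.support_take, Walk.drop_support_eq_support_drop_min, hmin]
    exact ((List.reverse_perm _).append_left _).trans (.of_eq (List.take_append_drop _ _))
  have hqh : q.IsHamiltonian := fun a ↦ (hq.count_eq a).trans (hp a)
  exact hqh.isHamiltonian_of_adj hcard hu.symm

lemma exists_isPath_top_of_lt_card (k : ℕ) (hk : k < Fintype.card α) :
    ∃ (u v : α) (p : (⊤ : SimpleGraph α).Walk u v), p.IsPath ∧ p.length = k := by
  induction k with
  | zero =>
    obtain ⟨a⟩ := Fintype.card_pos_iff.1 hk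
    exact ⟨a, a, .nil, .nil, rfl⟩
  | succ k ih =>
    obtain ⟨u, v, p, hp, hl⟩ := ih (by lia)
    obtain ⟨w, hw⟩ : ∃ w, w ∉ p.support.toFinset := by
      by_contra! h
      have := List.toFinset_card_le p.support
      rw [Finset.eq_univ_iff_forall.2 h, Finset.card_univ, Walk.length_support] at this
      lia
    rw [List.mem_toFinset] at hw
    have hne : w ≠ u := fun h ↦ hw (h ▸ p.start_mem_support)
    exact ⟨w, v, .cons (show (⊤ : SimpleGraph α).Adj w u from hne) p, hp.cons hw, by simp [hl]⟩

lemma isHamiltonian_top (hcard : 3 ≤ Fintype.card α) : (⊤ : SimpleGraph α).IsHamiltonian := by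
  obtain ⟨u, v, p, hp, hl⟩ := exists_isPath_top_of_lt_card (α := α) (Fintype.card α - 1) (by lia)
  have hne : v ≠ u := by
    rintro rfl
    rw [(Walk.isPath_iff_nil.1 hp).length_eq_zero] at hl
    lia
  exact (Walk.isHamiltonian_iff_isPath_and_length_eq.2 ⟨hp, hl⟩).isHamiltonian_of_adj hcard hne

/-- If adding the edge `uv` makes a graph Hamiltonian, then either it was already Hamiltonian or it
has a Hamiltonian path joining `u` and `v`. -/
lemma IsHamiltonian.exists_isHamiltonian_walk_of_sup_edge (h : (G ⊔ edge u v).IsHamiltonian)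
    (hcard : 3 ≤ Fintype.card α) (hG : ¬ G.IsHamiltonian) :
    ∃ p : G.Walk v u, p.IsHamiltonian := by
  have : Nontrivial α := Fintype.one_lt_card_iff_nontrivial.1 (by lia)
  obtain ⟨c, hc⟩ := h.exists_isHamiltonianCycle u
  have key : ∀ c : (G ⊔ edge u v).Walk u u, c.IsHamiltonianCycle → c.snd = v →
      ∃ p : G.Walk v u, p.IsHamiltonian := by
    rintro (_ | @⟨_, w, _, hadj, q⟩) hc hw
    · exact absurd rfl hc.ne_nil
    obtain rfl : w = v := by simpa using hw
    have hcyc := (Walk.cons_isCycle_iff _ _).1 hc.isCycle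
    have hlen := hc.length_eq
    rw [Walk.length_cons] at hlen
    have he : ∀ e ∈ q.edges, e ∈ G.edgeSet := by
      intro e heq
      have hmem := q.edges_subset_edgeSet heq
      have hne : e ≠ s(u, w) := fun h ↦ hcyc.2 (h ▸ heq)
      induction e with | h x y
      simp only [mem_edgeSet, sup_adj, adj_edge] at hmem ⊢
      grind
    refine ⟨q.transfer G he, Walk.isHamiltonian_iff_isPath_and_length_eq.2
      ⟨hcyc.1.transfer he, ?_⟩⟩
    rw [Walk.length_transfer]
    lia
  by_cases he : s(u, v) ∈ c.edges
  · by_cases hs : c.snd = v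
    · exact key c hc hs
    refine key c.reverse (Walk.isHamiltonianCycle_iff_isCycle_and_length_eq.2
      ⟨hc.isCycle.reverse, by simpa using hc.length_eq⟩) ?_
    rw [Walk.snd_reverse]
    have hnil := hc.isCycle.not_nil
    rw [← c.cons_tail_eq hnil, Walk.edges_cons, List.mem_cons] at he
    have he' : s(u, v) ∈ c.tail.edges := he.resolve_left fun h ↦ hs (by
      have := c.adj_snd hnil |>.ne
      grind)
    have htail : ¬ c.tail.Nil := fun h ↦ by
      rw [Walk.edges_eq_nil.2 h] at he'
      exact List.not_mem_nil he'
    have hpen := Walk.penultimate_cons_of_not_nil (c.adj_snd hnil) c.tail htail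
    rw [c.cons_tail_eq hnil] at hpen
    exact hpen.trans (hc.isHamiltonian_tail.isPath.eq_penultimate_of_mem_edges he').symm
  · refine absurd (fun _ ↦ ?_) hG
    have he' : ∀ e ∈ c.edges, e ∈ G.edgeSet := by
      intro e heq
      have hmem := c.edges_subset_edgeSet heq
      have hne : e ≠ s(u, v) := fun h ↦ he (h ▸ heq)
      induction e with | h x y
      simp only [mem_edgeSet, sup_adj, adj_edge] at hmem ⊢
      grind
    exact ⟨u, c.transfer G he', Walk.isHamiltonianCycle_iff_isCycle_and_length_eq.2
      ⟨hc.isCycle.transfer he', by simpa using hc.length_eq⟩⟩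

open Classical in
/-- The positions preceding a neighbour of the start of a Hamiltonian path are as many as the degree
of the start. -/
lemma Walk.IsHamiltonian.card_filter_adj_getVert_succ {p : G.Walk u v} (hp : p.IsHamiltonian) :
    ((Finset.range p.length).filter fun i ↦ G.Adj u (p.getVert (i + 1))).card = G.degree u := by
  rw [← card_neighborFinset_eq_degree]
  refine Finset.card_bij (fun i _ ↦ p.getVert (i + 1)) (by simp) ?_ ?_
  · intro i hi j hj hij
    simp only [Finset.mem_filter, Finset.mem_range] at hi hj
    have := hp.isPath.getVert_injOn (by simp; lia) (by simp; lia) hij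
    lia
  · intro w hw
    rw [mem_neighborFinset] at hw
    obtain ⟨i, rfl, hi⟩ := Walk.mem_support_iff_exists_getVert.1 (hp.mem_support w)
    obtain _ | i := i
    · simp at hw
    · exact ⟨i, by simpa using ⟨by lia, hw⟩, rfl⟩

open Classical in
/-- The positions of the neighbours of the end of a Hamiltonian path, counted. -/
lemma Walk.IsHamiltonian.card_filter_adj_getVert {p : G.Walk u v} (hp : p.IsHamiltonian) :
    ((Finset.range p.length).filter fun i ↦ G.Adj v (p.getVert i)).card = G.degree v := by
  rw [← card_neighborFinset_eq_degree]
  refine Finset.card_bij (fun i _ ↦ p.getVert i) (by simp) ?_ ?_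
  · intro i hi j hj hij
    simp only [Finset.mem_filter, Finset.mem_range] at hi hj
    exact hp.isPath.getVert_injOn (by simp; lia) (by simp; lia) hij
  · intro w hw
    rw [mem_neighborFinset] at hw
    obtain ⟨i, rfl, hi⟩ := Walk.mem_support_iff_exists_getVert.1 (hp.mem_support w)
    have : i ≠ p.length := by
      rintro rfl
      simp at hw
    exact ⟨i, by simpa using ⟨by lia, hw⟩, rfl⟩

open Classical in
/-- **Pósa's theorem**: a graph on `n ≥ 3` vertices in which, for every `1 ≤ j < n / 2`, fewer
than `j` vertices have degree at most `j`, is Hamiltonian. -/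
theorem isHamiltonian_of_posa (G : SimpleGraph α) (hcard : 3 ≤ Fintype.card α)
    (hG : ∀ j : ℕ, 1 ≤ j → 2 * j < Fintype.card α →
      (Finset.univ.filter fun x ↦ G.degree x ≤ j).card < j) : G.IsHamiltonian := by
  induction G using WellFoundedGT.induction with | ind G ih
  by_contra hnot
  have hne : (Finset.univ.filter fun e : α × α ↦ e.1 ≠ e.2 ∧ ¬ G.Adj e.1 e.2).Nonempty := by
    by_contra! h
    refine hnot ((isHamiltonian_top hcard).mono fun x y hxy ↦ ?_)
    have := Finset.filter_eq_empty_iff.1 h (Finset.mem_univ (x, y))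
    simp only [top_adj] at hxy
    tauto
  obtain ⟨⟨u, v⟩, huv, hmax⟩ := Finset.exists_max_image _ (fun e ↦ G.degree e.1 + G.degree e.2) hne
  simp only [Finset.mem_filter, Finset.mem_univ, true_and, Prod.forall] at huv hmax
  wlog hle : G.degree v ≤ G.degree u generalizing u v
  · exact this v u ⟨huv.1.symm, fun h ↦ huv.2 h.symm⟩
      (fun a b h ↦ (hmax a b h).trans (add_comm _ _).le) (by lia)
  have hdeg (H : SimpleGraph α) (hGH : G ≤ H) (x : α) : G.degree x ≤ H.degree x :=
    degree_le_of_le hGH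
  have hsup : (G ⊔ edge u v).IsHamiltonian := by
    refine ih _ (G.lt_sup_edge _ _ huv.1 huv.2) fun j h₁ h₂ ↦ ?_
    refine (Finset.card_le_card fun x hx ↦ ?_).trans_lt (hG j h₁ h₂)
    rw [Finset.mem_filter] at hx ⊢
    exact ⟨hx.1, (hdeg _ le_sup_left x).trans hx.2⟩
  obtain ⟨p, hp⟩ := hsup.exists_isHamiltonian_walk_of_sup_edge hcard hnot
  have hcross : ∀ i < p.length, G.Adj v (p.getVert (i + 1)) → ¬ G.Adj u (p.getVert i) :=
    fun i hi h₁ h₂ ↦ hnot (hp.isHamiltonian_of_crossing hcard hi h₁ h₂)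
  have hsum : G.degree v + G.degree u ≤ p.length := by
    rw [← hp.card_filter_adj_getVert_succ, ← hp.card_filter_adj_getVert,
      ← Finset.card_union_of_disjoint]
    · refine (Finset.card_le_card (Finset.union_subset (Finset.filter_subset _ _)
        (Finset.filter_subset _ _))).trans (Finset.card_range _).le
    · refine Finset.disjoint_left.2 fun i hi hi' ↦ ?_
      simp only [Finset.mem_filter, Finset.mem_range] at hi hi'
      exact hcross i hi.1 hi.2 hi'.2
  have hlow : G.degree v ≤ (Finset.univ.filter fun x ↦ G.degree x ≤ G.degree v).card := by
    conv_lhs => rw [← hp.card_filter_adj_getVert_succ]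
    refine Finset.card_le_card_of_injOn p.getVert ?_ ?_
    · intro i hi
      simp only [Finset.coe_filter, Finset.mem_range, Set.mem_ofPred_eq, Finset.mem_univ,
        true_and] at hi ⊢
      have hiu : u ≠ p.getVert i := fun h ↦
        hi.1.ne ((hp.isPath.getVert_eq_end_iff hi.1.le).1 h.symm)
      have := hmax _ _ ⟨hiu, hcross i hi.1 hi.2⟩
      lia
    · intro i hi j hj hij
      simp only [Finset.coe_filter, Finset.mem_range, Set.mem_ofPred_eq] at hi hj
      exact hp.isPath.getVert_injOn (by simp; lia) (by simp; lia) hij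
  have hlen := hp.length_eq
  obtain hv | hv := Nat.eq_zero_or_pos (G.degree v)
  · have := hG 1 le_rfl (by lia)
    rw [Nat.lt_one_iff, Finset.card_eq_zero, Finset.filter_eq_empty_iff] at this
    exact this (Finset.mem_univ v) (by lia)
  · exact (hG _ hv (by lia)).not_ge hlow

end SimpleGraph

/-- Nonstandard version of Pósa's theorem: if, for almost all `n`, for every `j ≥ 1` with
`2j < |X n|` the number of vertices of the finite graph `G n` (with at least 3 vertices)
of degree at most `j` is less than `j`, then the nonstandard graph is Hamiltonian. -/
theorem hamiltonian_ae_of_posa_ae (𝓤 : Ultrafilter ℕ) {X : ℕ → Type*}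
    [∀ n, Fintype (X n)] [∀ n, DecidableEq (X n)]
    (G : ∀ n, SimpleGraph (X n)) [∀ n, DecidableRel (G n).Adj]
    (hcard : ∀ n, 3 ≤ Fintype.card (X n))
    (h : {n | ∀ j : ℕ, 1 ≤ j → 2 * j < Fintype.card (X n) →
        (Finset.univ.filter fun x : X n => (G n).degree x ≤ j).card < j} ∈ 𝓤) :
    {n | (G n).IsHamiltonian} ∈ 𝓤 := by
  filter_upwards [h] with n hn
  exact (G n).isHamiltonian_of_posa (hcard n) fun j h₁ h₂ ↦ by convert hn j h₁ h₂
end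

section
/- Let 𝓤 be an ultrafilter on ℕ, let k be a natural number, and for each n let G n be a locally finite simple graph on a vertex type X n such that every vertex of G n has degree at most k. Then the ultraproduct graph *G (on the quotient *X of Π n, X n by 𝓤-almost-everywhere equality, with [x] adjacent to [y] iff {n | (G n).Adj (x n) (y n)} ∈ 𝓤) is (k+1)-colorable: there is a function c : *X → Fin (k+1) such that adjacent vertices of *G receive different colors. -/
open Filter

/-- The almost-everywhere-equality (mod the ultrafilter `𝓤`) setoid on `Π n, X n`. -/
def aeSetoid (𝓤 : Ultrafilter ℕ) (X : ℕ → Type*) : Setoid (∀ n, X n) where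
  r x y := {n | x n = y n} ∈ 𝓤
  iseqv := by
    refine ⟨fun x => ?_, fun {x y} h => ?_, fun {x y z} h1 h2 => ?_⟩
    · exact Filter.univ_mem' fun n => rfl
    · filter_upwards [h] with n hn using hn.symm
    · filter_upwards [h1, h2] with n hn1 hn2 using hn1.trans hn2

/-- The nonstandard adjacency relation on the ultraproduct vertex set:
`[x]` is adjacent to `[y]` iff `{n | (G n).Adj (x n) (y n)} ∈ 𝓤`. -/
def AdjStar (𝓤 : Ultrafilter ℕ) {X : ℕ → Type*} (G : ∀ n, SimpleGraph (X n)) :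
    Quotient (aeSetoid 𝓤 X) → Quotient (aeSetoid 𝓤 X) → Prop :=
  Quotient.lift₂ (fun x y => {n | (G n).Adj (x n) (y n)} ∈ 𝓤)
    (by
      intro x y x' y' hx hy
      have hx' : {n | x n = x' n} ∈ 𝓤 := hx
      have hy' : {n | y n = y' n} ∈ 𝓤 := hy
      apply propext
      constructor
      · intro h
        filter_upwards [hx', hy', h] with n h1 h2 h3
        rw [← h1, ← h2]; exact h3
      · intro h
        filter_upwards [hx', hy', h] with n h1 h2 h3
        rw [h1, h2]; exact h3)

/-- A graph in which no vertex has `k + 1` distinct neighbors is `(k + 1)`-colorable, by greedy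
coloring along a well-order of the vertices. -/
theorem SimpleGraph.colorable_succ_of_isEmpty_embedding_neighborSet {V : Type*}
    (G : SimpleGraph V) (k : ℕ) (h : ∀ v, IsEmpty (Fin (k + 1) ↪ G.neighborSet v)) :
    G.Colorable (k + 1) := by
  have wf : WellFounded (WellOrderingRel (α := V)) := WellOrderingRel.isWellOrder.wf
  let F (v : V) (ih : ∀ w, WellOrderingRel w v → Fin (k + 1)) : Fin (k + 1) :=
    Classical.epsilon fun i => ∀ w (hw : WellOrderingRel w v), G.Adj v w → ih w hw ≠ i
  let c : V → Fin (k + 1) := wf.fix F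
  have hc (v w : V) (hw : WellOrderingRel w v) (hvw : G.Adj v w) : c w ≠ c v := by
    have hex : ∃ i, ∀ w, WellOrderingRel w v → G.Adj v w → c w ≠ i := by
      by_contra! hall
      choose f _ hadj hcol using hall
      exact (h v).false ⟨fun i => ⟨f i, hadj i⟩, fun i j hij => by
        rw [← hcol i, ← hcol j, show f i = f j from congrArg Subtype.val hij]⟩
    have heq : c v = Classical.epsilon fun i => ∀ w, WellOrderingRel w v → G.Adj v w → c w ≠ i :=
      wf.fix_eq F v
    rw [heq]
    exact Classical.epsilon_spec hex w hw hvw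
  refine ⟨SimpleGraph.Coloring.mk c fun {u v} huv => ?_⟩
  rcases trichotomous_of WellOrderingRel u v with hlt | rfl | hlt
  · exact hc v u hlt huv.symm
  · exact absurd huv G.irrefl
  · exact (hc u v hlt huv).symm

/-- The ultraproduct of a sequence of simple graphs. -/
def ultraproductGraph (𝓤 : Ultrafilter ℕ) {X : ℕ → Type*} (G : ∀ n, SimpleGraph (X n)) :
    SimpleGraph (Quotient (aeSetoid 𝓤 X)) where
  Adj := AdjStar 𝓤 G
  symm := ⟨by
    rintro ⟨x⟩ ⟨y⟩ (h : {n | (G n).Adj (x n) (y n)} ∈ 𝓤)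
    change {n | (G n).Adj (y n) (x n)} ∈ 𝓤
    simpa only [SimpleGraph.adj_comm] using h⟩
  loopless := ⟨by
    rintro ⟨x⟩ (h : {n | (G n).Adj (x n) (x n)} ∈ 𝓤)
    obtain ⟨n, hn⟩ := 𝓤.nonempty_of_mem h
    exact (G n).irrefl hn⟩

/-- If all degrees in the graphs `G n` are at most `k`, then no vertex of their ultraproduct has
`k + 1` distinct neighbors. -/
theorem isEmpty_embedding_neighborSet_ultraproductGraph (𝓤 : Ultrafilter ℕ) (k : ℕ)
    {X : ℕ → Type*} (G : ∀ n, SimpleGraph (X n)) [∀ n (x : X n), Fintype ((G n).neighborSet x)]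
    (hdeg : ∀ n (x : X n), (G n).degree x ≤ k) (u : Quotient (aeSetoid 𝓤 X)) :
    IsEmpty (Fin (k + 1) ↪ (ultraproductGraph 𝓤 G).neighborSet u) := by
  refine ⟨fun f => ?_⟩
  obtain ⟨x, rfl⟩ := Quotient.exists_rep u
  choose y hy using fun i => Quotient.exists_rep (f i).1
  have hadj (i : Fin (k + 1)) : ∀ᶠ n in 𝓤, (G n).Adj (x n) (y i n) := by
    have hi : AdjStar 𝓤 G (Quotient.mk _ x) (f i).1 := (f i).2
    rw [← hy i] at hi
    exact hi
  have hne (i j : Fin (k + 1)) : ∀ᶠ n in 𝓤, y i n = y j n → i = j := by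
    by_cases hij : i = j
    · exact .of_forall fun _ _ => hij
    · have hnot : ¬ ∀ᶠ n in 𝓤, y i n = y j n := fun hae =>
        hij <| f.injective <| Subtype.ext <| by
          rw [← hy i, ← hy j]
          exact Quotient.sound hae
      filter_upwards [Ultrafilter.eventually_not.2 hnot] with n hn heq using absurd heq hn
  obtain ⟨n, hn, hinj⟩ :=
    ((eventually_all.2 hadj).and (eventually_all.2 fun i => eventually_all.2 (hne i))).exists
  have hcard := Fintype.card_le_of_injective
    (fun i => (⟨y i n, hn i⟩ : (G n).neighborSet (x n)))
    fun i j hij => hinj i j (congrArg Subtype.val hij)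
  rw [Fintype.card_fin, SimpleGraph.card_neighborSet_eq_degree] at hcard
  exact absurd (hdeg n (x n)) (by omega)

/-- Nonstandard coloring theorem: if every vertex of every `G n` has degree at most `k`,
then the ultraproduct graph `*G` is `(k+1)`-colorable. -/
theorem adjStar_colorable (𝓤 : Ultrafilter ℕ) (k : ℕ) {X : ℕ → Type*}
    (G : ∀ n, SimpleGraph (X n)) [∀ n (x : X n), Fintype ((G n).neighborSet x)]
    (hdeg : ∀ n (x : X n), (G n).degree x ≤ k) :
    ∃ c : Quotient (aeSetoid 𝓤 X) → Fin (k + 1),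
      ∀ u v : Quotient (aeSetoid 𝓤 X), AdjStar 𝓤 G u v → c u ≠ c v := by
  obtain ⟨c⟩ := (ultraproductGraph 𝓤 G).colorable_succ_of_isEmpty_embedding_neighborSet k
    (isEmpty_embedding_neighborSet_ultraproductGraph 𝓤 k G hdeg)
  exact ⟨c, fun _ _ huv => c.valid huv⟩
end
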